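/- Let q = r^2 be an even power of a prime. For i = 1,2 let C_i be an additive code in F_q^n with |C_i| = K_i and minimum distance d_i. If C_1^⊥tr ⊆ C_2, then there exists an asymmetric quantum code with parameters ((n, |C_2|/|C_1^⊥tr|, d_z/d_x))_q where {d_z, d_x} = {d_1, d_2}; in particular, one exists with d_z = d_1 and d_x = d_2. -/

import Mathlib

open scoped Classical

noncomputable section

namespace AQC

/-- Hamming weight of a vector: the number of nonzero entries. -/
def wt {n : ℕ} {α : Type*} [Zero α] (u : Fin n → α) : ℕ :=
  (Finset.univ.filter (fun i => u i ≠ 0)).card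

variable (p m n : ℕ) [Fact p.Prime]

instance : Fintype (GaloisField p m) := Fintype.ofFinite _

/-- Words of length `n` over the field `F_q` with `q = p ^ m`. -/
abbrev Word := Fin n → GaloisField p m

/-- The usual dot product `u · v = ∑ i, u i * v i` on `F_q ^ n`. -/
def dotW (u v : Word p m n) : GaloisField p m := ∑ i, u i * v i

/-- The state space `V_n = ℂ^(F_q^n)`. -/
abbrev QV := Word p m n → ℂ

/-- The trace map `T : F_q → F_p`. -/
def gfTr (x : GaloisField p m) : ZMod p := Algebra.trace (ZMod p) (GaloisField p m) x

/-- `η = exp(2πi/p)`, a primitive `p`-th root of unity. -/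
def eta : ℂ := Complex.exp (2 * Real.pi * Complex.I / p)

/-- The additive character `x ↦ η ^ x` of `F_p`. -/
def chi (x : ZMod p) : ℂ := eta p ^ x.val

/-- The Hermitian inner product `⟨u|v⟩ = ∑ c, conj (u c) * v c` on the state space. -/
def hInner (u v : QV p m n) : ℂ := ∑ c, (starRingEnd ℂ) (u c) * v c

/-- The error operator `e = X(a)Z(b)`, acting by `e|c⟩ = η^{T(b·c)} |a+c⟩`. -/
def errOp (a b : Word p m n) : QV p m n →ₗ[ℂ] QV p m n where
  toFun f := fun x => chi p (gfTr p m (dotW p m n b (x - a))) * f (x - a)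
  map_add' f g := by funext x; simp [mul_add]
  map_smul' c f := by funext x; simp; ring

/-- Purity of an asymmetric quantum code with parameters `((n,K,d_z/d_x))_q`. -/
def IsPureAQEC (Q : Submodule ℂ (QV p m n)) (dz dx : ℕ) : Prop :=
  ∀ u ∈ Q, ∀ v ∈ Q, ∀ a b : Word p m n,
    1 ≤ wt a → wt a ≤ dx - 1 → 1 ≤ wt b → wt b ≤ dz - 1 →
      hInner p m n u (errOp p m n a b v) = 0

/-- `Q` is an asymmetric quantum code with parameters `((n,K,d_z/d_x))_q`:
a `K`-dimensional subspace of `V_n` detecting `d_x - 1` qudits of `X`-errors and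
`d_z - 1` qudits of `Z`-errors; a code with `K = 1` is required to be pure. -/
def IsAQEC (Q : Submodule ℂ (QV p m n)) (K dz dx : ℕ) : Prop :=
  Module.finrank ℂ Q = K ∧ 1 ≤ K ∧
  (∀ u ∈ Q, ∀ v ∈ Q, hInner p m n u v = 0 →
    ∀ a b : Word p m n, wt a ≤ dx - 1 → wt b ≤ dz - 1 →
      hInner p m n u (errOp p m n a b v) = 0) ∧
  (K = 1 → IsPureAQEC p m n Q dz dx)

/-- Minimum distance of a set of words (`0` if the set has no nonzero element). -/
def minDistS {n : ℕ} {α : Type*} [Zero α] (S : Set (Fin n → α)) : ℕ :=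
  sInf {d | ∃ u ∈ S, u ≠ 0 ∧ wt u = d}

/-- Trace Hermitian dual of a subset of `F_q^n`, `q = r²`, where conjugation is
`x ↦ x ^ r` and `α` is a fixed nonzero element with `α ^ r = -α` (`α = 1` if `p = 2`,
in which case this is `{u | ∀ v ∈ S, ∑ i, (u i * v i ^ r + u i ^ r * v i) = 0}`). -/
def dualTr (r : ℕ) (α : GaloisField p m) (S : Set (Word p m n)) : Set (Word p m n) :=
  {u | ∀ v ∈ S, α * ∑ i, (u i * (v i) ^ r - (u i) ^ r * v i) = 0}


theorem chi_add (p : ℕ) [Fact p.Prime] (x y : ZMod p) : chi p (x + y) = chi p x * chi p y := by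
  have hp : p ≠ 0 := (Fact.out : p.Prime).ne_zero
  have h := Complex.isPrimitiveRoot_exp p hp
  unfold chi
  rw [← pow_add, ZMod.val_add]
  exact (pow_eq_pow_mod _ h.pow_eq_one).symm

theorem chi_eq_one (p : ℕ) [Fact p.Prime] (x : ZMod p) (hx : chi p x = 1) : x = 0 := by
  have hp : p ≠ 0 := (Fact.out : p.Prime).ne_zero
  have h := Complex.isPrimitiveRoot_exp p hp
  have h2 : p ∣ x.val := h.dvd_of_pow_eq_one _ hx
  have h3 := ZMod.val_lt x
  exact (ZMod.val_eq_zero x).1 (Nat.eq_zero_of_dvd_of_lt h2 h3)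

theorem chi_zero (p : ℕ) [Fact p.Prime] : chi p 0 = 1 := by simp [chi]

/-- The trace bilinear form on words. -/
def tform (p m n : ℕ) [Fact p.Prime] : LinearMap.BilinForm (ZMod p) (Word p m n) :=
  LinearMap.mk₂ (ZMod p) (fun u v => gfTr p m (dotW p m n u v))
    (fun u v w => by simp [gfTr, dotW, add_mul, Finset.sum_add_distrib])
    (fun c u v => by simp only [gfTr, dotW, Pi.smul_apply, smul_mul_assoc, ← Finset.smul_sum, map_smul])
    (fun u v w => by simp [gfTr, dotW, mul_add, Finset.sum_add_distrib])
    (fun c u v => by simp only [gfTr, dotW, Pi.smul_apply, mul_smul_comm, ← Finset.smul_sum, map_smul])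

theorem tform_apply (p m n : ℕ) [Fact p.Prime] (u v : Word p m n) :
    tform p m n u v = gfTr p m (dotW p m n u v) := rfl

theorem dotW_comm (p m n : ℕ) [Fact p.Prime] (u v : Word p m n) :
    dotW p m n u v = dotW p m n v u := by
  simp [dotW, mul_comm]

theorem tform_refl (p m n : ℕ) [Fact p.Prime] : (tform p m n).IsRefl := by
  intro u v h
  rw [tform_apply, dotW_comm, ← tform_apply]
  exact h

theorem gfTr_eq_zero (p m : ℕ) [Fact p.Prime] (x : GaloisField p m)
    (h : ∀ y, gfTr p m (x * y) = 0) : x = 0 := by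
  have := traceForm_nondegenerate (ZMod p) (GaloisField p m)
  exact this.1 x h

theorem tform_nondeg (p m n : ℕ) [Fact p.Prime] : (tform p m n).Nondegenerate := by
  have key : ∀ u : Word p m n, (∀ v, tform p m n u v = 0) → u = 0 := by
    intro u hu
    funext i
    apply gfTr_eq_zero
    intro y
    have := hu (Pi.single i y)
    rw [tform_apply] at this
    rw [← this]
    congr 1
    unfold dotW
    rw [Finset.sum_eq_single i]
    · simp
    · intro j _ hj; simp [hj]
    · simp
  refine ⟨key, fun v hv => key v fun u => ?_⟩
  exact tform_refl p m n _ _ (hv u)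

/-- Encoding map of the CSS code. -/
def encL (p m n : ℕ) [Fact p.Prime] (D C : AddSubgroup (Word p m n)) :
    ((C ⧸ D.addSubgroupOf C) → ℂ) →ₗ[ℂ] QV p m n where
  toFun g := fun x => if h : x ∈ C then g (QuotientAddGroup.mk ⟨x, h⟩) else 0
  map_add' f g := by
    funext x
    by_cases h : x ∈ C <;> simp [h]
  map_smul' c f := by
    funext x
    by_cases h : x ∈ C <;> simp [h]

theorem encL_inj (p m n : ℕ) [Fact p.Prime] (D C : AddSubgroup (Word p m n)) :
    Function.Injective (encL p m n D C) := by
  intro f g h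
  funext y
  obtain ⟨⟨x, hx⟩, rfl⟩ := QuotientAddGroup.mk_surjective y
  have := congrFun h x
  simpa [encL, hx] using this

theorem encL_inv (p m n : ℕ) [Fact p.Prime] (D C : AddSubgroup (Word p m n)) (hDC : D ≤ C)
    (u : QV p m n) (hu : u ∈ LinearMap.range (encL p m n D C)) (x d : Word p m n) (hd : d ∈ D) :
    u (x + d) = u x := by
  obtain ⟨g, rfl⟩ := hu
  by_cases hx : x ∈ C
  · have hxd : x + d ∈ C := C.add_mem hx (hDC hd)
    simp only [encL, LinearMap.coe_mk, AddHom.coe_mk, hx, hxd, dif_pos]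
    congr 1
    rw [QuotientAddGroup.eq, AddSubgroup.mem_addSubgroupOf]
    simpa using hd
  · have hxd : x + d ∉ C := fun h => hx (by simpa using C.sub_mem h (hDC hd))
    simp [encL, hx, hxd]

theorem encL_supp (p m n : ℕ) [Fact p.Prime] (D C : AddSubgroup (Word p m n))
    (u : QV p m n) (hu : u ∈ LinearMap.range (encL p m n D C)) (x : Word p m n) (hx : x ∉ C) :
    u x = 0 := by
  obtain ⟨g, rfl⟩ := hu
  simp [encL, hx]

theorem css (p m n : ℕ) [Fact p.Prime] (D C : AddSubgroup (Word p m n)) (hDC : D ≤ C)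
    (dz dx : ℕ) (hx : ∀ a ∈ C, wt a ≤ dx - 1 → a = 0)
    (hz : ∀ b : Word p m n, (∀ c ∈ D, tform p m n b c = 0) → wt b ≤ dz - 1 → b = 0) :
    ∃ Q : Submodule ℂ (QV p m n), IsAQEC p m n Q (Nat.card C / Nat.card D) dz dx := by
  have hK : Nat.card C / Nat.card D = Nat.card (C ⧸ D.addSubgroupOf C) := by
    have h1 := AddSubgroup.card_eq_card_quotient_mul_card_addSubgroup (D.addSubgroupOf C)
    have h2 := Nat.card_congr (AddSubgroup.addSubgroupOfEquivOfLe hDC).toEquiv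
    rw [h1, h2]
    exact Nat.mul_div_cancel _ Nat.card_pos
  have hX : ∀ u ∈ LinearMap.range (encL p m n D C), ∀ v ∈ LinearMap.range (encL p m n D C),
      ∀ a b : Word p m n, a ∉ C → hInner p m n u (errOp p m n a b v) = 0 := by
    intro u hu v hv a b ha
    unfold hInner
    apply Finset.sum_eq_zero
    intro c _
    by_cases hc : c ∈ C
    · have : c - a ∉ C := fun h => ha (by simpa using C.sub_mem hc h)
      have h3 := encL_supp p m n D C v hv _ this
      simp [errOp, h3]
    · simp [encL_supp p m n D C u hu c hc]
  refine ⟨LinearMap.range (encL p m n D C), ?_, ?_, ?_, ?_⟩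
  · rw [LinearMap.finrank_range_of_inj (encL_inj p m n D C), hK]
    have : Fintype (C ⧸ D.addSubgroupOf C) := Fintype.ofFinite _
    rw [Module.finrank_fintype_fun_eq_card, Nat.card_eq_fintype_card]
  · rw [hK]; exact Nat.card_pos
  · intro u hu v hv huv a b ha hb
    by_cases haC : a ∈ C
    · have ha0 := hx a haC ha
      subst ha0
      by_cases hbD : ∀ c ∈ D, tform p m n b c = 0
      · have hb0 := hz b hbD hb
        subst hb0
        rw [← huv]
        congr 1
        funext x
        simp [errOp, dotW, gfTr, chi_zero]
      · push Not at hbD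
        obtain ⟨d, hd, hbd⟩ := hbD
        have hchi : chi p (tform p m n b d) ≠ 1 := fun h => hbd (chi_eq_one p _ h)
        have hsum : hInner p m n u (errOp p m n 0 b v)
            = chi p (tform p m n b d) * hInner p m n u (errOp p m n 0 b v) := by
          conv_lhs => unfold hInner
          rw [← Equiv.sum_comp (Equiv.addRight d)]
          unfold hInner
          rw [Finset.mul_sum]
          apply Finset.sum_congr rfl
          intro c _
          simp only [Equiv.coe_addRight, errOp, LinearMap.coe_mk, AddHom.coe_mk, sub_zero]
          rw [encL_inv p m n D C hDC u hu c d hd, encL_inv p m n D C hDC v hv c d hd,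
            ← tform_apply, ← tform_apply, map_add, chi_add]
          ring
        have : (1 - chi p (tform p m n b d)) * hInner p m n u (errOp p m n 0 b v) = 0 := by
          rw [sub_mul, one_mul, ← hsum, sub_self]
        rcases mul_eq_zero.1 this with h | h
        · exact absurd (sub_eq_zero.1 h).symm hchi
        · exact h
    · exact hX u hu v hv a b haC
  · intro _ u hu v hv a b h1 h2 _ _
    apply hX u hu v hv
    intro haC
    have := hx a haC h2
    subst this
    simp [wt] at h1

theorem min_zero {p m n : ℕ} [Fact p.Prime] (S : Set (Word p m n)) (a : Word p m n) (ha : a ∈ S)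
    (h : wt a ≤ minDistS S - 1) : a = 0 := by
  by_contra h0
  have h1 : minDistS S ≤ wt a := Nat.sInf_le ⟨a, ha, h0, rfl⟩
  have h2 : 0 < wt a := by
    unfold wt
    rw [Finset.card_pos]
    obtain ⟨i, hi⟩ := Function.ne_iff.1 h0
    exact ⟨i, by simpa using hi⟩
  omega

theorem gfTr_pow (p m k : ℕ) [Fact p.Prime] (x : GaloisField p m) :
    gfTr p m (x ^ p ^ k) = gfTr p m x := by
  induction k with
  | zero => simp
  | succ k ih =>
    rw [pow_succ, pow_mul, ← ih]
    have := Algebra.trace_eq_of_algEquiv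
      (FiniteField.frobeniusAlgEquivOfAlgebraic (ZMod p) (GaloisField p m)) (x ^ p ^ k)
    simpa [gfTr] using this

theorem gfTr_anti (p f : ℕ) [Fact p.Prime] (hf : f ≠ 0) (x : GaloisField p (2 * f))
    (hx : x + x ^ p ^ f = 0) : gfTr p (2 * f) x = 0 := by
  have h := FiniteField.algebraMap_trace_eq_sum_pow (ZMod p) (GaloisField p (2 * f)) x
  have hr : ∀ g : ℕ → GaloisField p (2 * f), ∑ i ∈ Finset.range (2 * f), g i
      = ∑ i ∈ Finset.range f, (g i + g (f + i)) := by
    intro g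
    rw [show Finset.range (2 * f) = Finset.range (f + f) by rw [two_mul], Finset.sum_range_add,
      Finset.sum_add_distrib]
  rw [GaloisField.finrank p (by omega), hr, Nat.card_zmod] at h
  rw [Finset.sum_eq_zero] at h
  · exact (map_eq_zero _).1 h
  · intro i _
    rw [pow_add, pow_mul, ← add_pow_char_pow, hx]
    exact zero_pow (pow_ne_zero _ (Fact.out : p.Prime).ne_zero)

theorem pow_pow_self (p f : ℕ) [Fact p.Prime] (hf : f ≠ 0) (x : GaloisField p (2 * f)) :
    (x ^ p ^ f) ^ p ^ f = x := by
  rw [← pow_mul, ← pow_add, ← two_mul]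
  have h := FiniteField.pow_card x
  rwa [← Nat.card_eq_fintype_card, GaloisField.card p _ (by omega)] at h

theorem anti_of_gfTr (p f : ℕ) [Fact p.Prime] (hf : f ≠ 0) (x : GaloisField p (2 * f))
    (hx : ∀ l : GaloisField p (2 * f), l ^ p ^ f = l → gfTr p (2 * f) (l * x) = 0) :
    x + x ^ p ^ f = 0 := by
  apply gfTr_eq_zero
  intro y
  have h := hx (y + y ^ p ^ f) (by rw [add_pow_char_pow, pow_pow_self p f hf, add_comm])
  rw [← h, add_mul, add_mul]
  have h2 := gfTr_pow p (2 * f) f (y ^ p ^ f * x)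
  rw [mul_pow, pow_pow_self p f hf] at h2
  simp only [gfTr, map_add] at h2 ⊢
  rw [mul_comm x y, mul_comm _ y, h2]

/-- The map `v ↦ α v^r`. -/
def conjA (p f n : ℕ) [Fact p.Prime] (α : GaloisField p (2 * f)) :
    Word p (2 * f) n →+ Word p (2 * f) n where
  toFun v := fun i => α * v i ^ p ^ f
  map_zero' := by
    funext i
    simp [(Fact.out : p.Prime).ne_zero]
  map_add' u v := by
    funext i
    simp [add_pow_char_pow, mul_add]

theorem wt_conjA (p f n : ℕ) [Fact p.Prime] (α : GaloisField p (2 * f)) (hα : α ≠ 0)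
    (v : Word p (2 * f) n) : wt (conjA p f n α v) = wt v := by
  unfold wt
  congr 1
  ext i
  simp [conjA, hα, (Fact.out : p.Prime).ne_zero]

theorem mem_dual (p f n : ℕ) [Fact p.Prime] (hf : f ≠ 0) (α : GaloisField p (2 * f))
    (hαr : α ^ p ^ f = -α) (C₁ : AddSubgroup (Word p (2 * f) n))
    (hlin₁ : ∀ x : GaloisField p (2 * f), x ^ p ^ f = x → ∀ u ∈ C₁, x • u ∈ C₁)
    (u : Word p (2 * f) n) :
    u ∈ dualTr p (2 * f) n (p ^ f) α (C₁ : Set (Word p (2 * f) n)) ↔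
      ∀ v ∈ C₁, tform p (2 * f) n (conjA p f n α v) u = 0 := by
  have hx : ∀ v : Word p (2 * f) n, α * ∑ i, (u i * (v i) ^ p ^ f - (u i) ^ p ^ f * v i) =
      dotW p (2 * f) n (conjA p f n α v) u + dotW p (2 * f) n (conjA p f n α v) u ^ p ^ f := by
    intro v
    unfold dotW
    rw [sum_pow_char_pow, ← Finset.sum_add_distrib, Finset.mul_sum]
    apply Finset.sum_congr rfl
    intro i _
    simp only [conjA, AddMonoidHom.coe_mk, ZeroHom.coe_mk, mul_pow, pow_pow_self p f hf, hαr]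
    ring
  constructor
  · intro h v hv
    have := h v hv
    rw [hx] at this
    exact gfTr_anti p f hf _ this
  · intro h v hv
    rw [hx]
    apply anti_of_gfTr p f hf
    intro l hl
    have h2 := h (l • v) (hlin₁ l hl v hv)
    rw [tform_apply] at h2
    rw [← h2]
    congr 1
    unfold dotW
    rw [Finset.mul_sum]
    apply Finset.sum_congr rfl
    intro i _
    simp only [conjA, AddMonoidHom.coe_mk, ZeroHom.coe_mk, mul_pow, hl, Pi.smul_apply, smul_eq_mul]
    ring

/-- Theorem 3.5: from nested additive codes `C_1^⊥tr ⊆ C_2` over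
`F_q`, `q = r²`, with minimum distances `d_1, d_2`, one obtains an asymmetric quantum
code with parameters `((n, |C_2|/|C_1^⊥tr|, d_z/d_x))_q`, where
`{d_z, d_x} = {d_1, d_2}`; in particular one with `d_z = d_1`, `d_x = d_2`. -/
theorem statement8 (p f n K₁ K₂ d₁ d₂ : ℕ) [Fact p.Prime] (hf : f ≠ 0) (hn : 0 < n)
    (α : GaloisField p (2 * f)) (hα0 : α ≠ 0) (hαr : α ^ p ^ f = -α)
    (hα1 : p = 2 → α = 1)
    (C₁ C₂ : AddSubgroup (Word p (2 * f) n))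
    (hlin₁ : ∀ x : GaloisField p (2 * f), x ^ p ^ f = x → ∀ u ∈ C₁, x • u ∈ C₁)
    (hlin₂ : ∀ x : GaloisField p (2 * f), x ^ p ^ f = x → ∀ u ∈ C₂, x • u ∈ C₂)
    (hK₁ : Nat.card C₁ = K₁) (hK₂ : Nat.card C₂ = K₂)
    (hd₁ : minDistS (C₁ : Set (Word p (2 * f) n)) = d₁)
    (hd₂ : minDistS (C₂ : Set (Word p (2 * f) n)) = d₂)
    (hsub : dualTr p (2 * f) n (p ^ f) α (C₁ : Set (Word p (2 * f) n))
              ⊆ (C₂ : Set (Word p (2 * f) n))) :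
    (∃ Q : Submodule ℂ (QV p (2 * f) n),
      IsAQEC p (2 * f) n Q
        (Nat.card C₂ /
          Nat.card (dualTr p (2 * f) n (p ^ f) α (C₁ : Set (Word p (2 * f) n))))
        d₁ d₂) ∧
    (∃ Q : Submodule ℂ (QV p (2 * f) n),
      IsAQEC p (2 * f) n Q
        (Nat.card C₂ /
          Nat.card (dualTr p (2 * f) n (p ^ f) α (C₁ : Set (Word p (2 * f) n))))
        d₂ d₁) := by
  set T := tform p (2 * f) n with hT
  set B : Submodule (ZMod p) (Word p (2 * f) n) :=
    AddSubgroup.toZModSubmodule p (C₁.map (conjA p f n α)) with hB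
  set C : Submodule (ZMod p) (Word p (2 * f) n) := AddSubgroup.toZModSubmodule p C₂ with hC
  have hnd := tform_nondeg p (2 * f) n
  have hrf := tform_refl p (2 * f) n
  have hBB : T.orthogonal (T.orthogonal B) = B :=
    LinearMap.BilinForm.orthogonal_orthogonal hnd hrf B
  have hCC : T.orthogonal (T.orthogonal C) = C :=
    LinearMap.BilinForm.orthogonal_orthogonal hnd hrf C
  have hD : dualTr p (2 * f) n (p ^ f) α (C₁ : Set (Word p (2 * f) n))
      = ((T.orthogonal B : Submodule (ZMod p) (Word p (2 * f) n)) : Set (Word p (2 * f) n)) := by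
    ext u
    rw [mem_dual p f n hf α hαr C₁ hlin₁ u]
    constructor
    · rintro h _ ⟨v, hv, rfl⟩
      exact h v hv
    · intro h v hv
      exact h _ ⟨v, hv, rfl⟩
  rw [hD] at hsub ⊢
  have hDC : T.orthogonal B ≤ C := hsub
  have hCB : T.orthogonal C ≤ B := by
    rw [← hBB]
    exact LinearMap.BilinForm.orthogonal_le hDC
  have hwB : ∀ b ∈ B, wt b ≤ d₁ - 1 → b = 0 := by
    rintro _ ⟨v, hv, rfl⟩ hw
    rw [wt_conjA p f n α hα0, ← hd₁] at hw
    rw [min_zero _ v hv hw, map_zero]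
  have hwC : ∀ c ∈ C, wt c ≤ d₂ - 1 → c = 0 := by
    intro c hc hw
    rw [← hd₂] at hw
    exact min_zero _ c hc hw
  constructor
  · refine css p (2 * f) n (T.orthogonal B).toAddSubgroup C₂ hDC d₁ d₂ hwC ?_
    intro b hb
    apply hwB
    rw [← hBB]
    exact fun c hc => hrf _ _ (hb c hc)
  · have := css p (2 * f) n (T.orthogonal C).toAddSubgroup B.toAddSubgroup hCB d₂ d₁ hwB ?_
    · have hcard : Nat.card B.toAddSubgroup / Nat.card (T.orthogonal C).toAddSubgroup
          = Nat.card C₂ / Nat.card (T.orthogonal B) := by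
        change Nat.card B / Nat.card (T.orthogonal C) = Nat.card C / Nat.card (T.orthogonal B)
        have hp : 0 < p := (Fact.out : p.Prime).pos
        have h1 := Submodule.finrank_mono hDC
        have h2 := Submodule.finrank_mono hCB
        have e1 := LinearMap.BilinForm.finrank_orthogonal hnd B
        have e2 := LinearMap.BilinForm.finrank_orthogonal hnd C
        have g1 := Submodule.finrank_le B
        have g2 := Submodule.finrank_le C
        have hc : ∀ W : Submodule (ZMod p) (Word p (2 * f) n),
            Nat.card W = p ^ Module.finrank (ZMod p) W := by
          intro W
          rw [Module.natCard_eq_pow_finrank (K := ZMod p) (V := W), Nat.card_zmod]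
        rw [hc, hc, hc, hc, Nat.pow_div h1 hp, Nat.pow_div h2 hp]
        congr 1
        rw [← hT] at e1 e2
        omega
      rw [hcard] at this
      exact this
    · intro b hb
      apply hwC
      rw [← hCC]
      exact fun c hc => hrf _ _ (hb c hc)
end AQC
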